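/- arXiv:2302.05308 — 2 statements merged into one kernel-verified Lean document; each statement's English description precedes it below -/
import Mathlib

section
/- Let Θ = {θ₁, …, θ_n} be a finite set of positive rational numbers contained in a union of segments [a₁; b₁] ∪ … ∪ [a_m; b_m] where 0 < a_i ≤ b_i for each i. Let F(x) = Σ_{θ ∈ Θ} (a_θ cos(2πθx) + b_θ sin(2πθx)) with real coefficients a_θ, b_θ not all zero. Then min(ρ₊(F), ρ₋(F)) ≥ ∏_{i=1}^{m} 1/(1 + b_i/a_i). -/
open MeasureTheory
open scoped Real

open scoped ComplexConjugate FourierTransform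

theorem coe_fourierChar_add (s t : ℝ) : (𝐞 (s + t) : ℂ) = 𝐞 s * 𝐞 t := by
  rw [AddChar.map_add_eq_mul, Circle.coe_mul]

theorem coe_fourierChar_neg (t : ℝ) : (𝐞 (-t) : ℂ) = conj (𝐞 t : ℂ) := by
  rw [AddChar.map_neg_eq_inv, Circle.coe_inv_eq_conj]

theorem coe_fourierChar_sum {ι : Type*} (s : Finset ι) (f : ι → ℝ) :
    (𝐞 (∑ i ∈ s, f i) : ℂ) = ∏ i ∈ s, (𝐞 (f i) : ℂ) := by
  induction s using Finset.cons_induction with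
  | empty => simp
  | cons i s hi ih => rw [Finset.sum_cons, Finset.prod_cons, coe_fourierChar_add, ih]

theorem sum_fourierChar_eq_zero {n : ℕ} (hn : 0 < n) {z : ℤ} (hz : ¬ (n : ℤ) ∣ z) :
    ∑ j : Fin n, (𝐞 (z * (j : ℕ) / n : ℝ) : ℂ) = 0 := by
  have hn' : (n : ℝ) ≠ 0 := by positivity
  have hpow (j : ℕ) : (𝐞 (z * j / n : ℝ) : ℂ) = (𝐞 (z / n : ℝ) : ℂ) ^ j := by
    rw [← Circle.coe_pow, ← AddChar.map_nsmul_eq_pow, nsmul_eq_mul]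
    congr 2
    ring
  have hone : (𝐞 (z / n : ℝ) : ℂ) ≠ 1 := by
    intro h
    rw [Real.fourierChar_apply, Complex.exp_eq_one_iff] at h
    obtain ⟨k, hk⟩ := h
    have h1 : ((2 * π * (z / n) : ℝ) : ℂ) = ((k * (2 * π) : ℝ) : ℂ) := by
      apply mul_right_cancel₀ Complex.I_ne_zero
      rw [hk]
      push_cast
      ring
    have h2 : 2 * π * (z / n) = k * (2 * π) := by exact_mod_cast h1
    have h3 : (z : ℝ) = n * k := by
      have := Real.pi_pos
      field_simp at h2
      linarith
    exact hz ⟨k, by exact_mod_cast h3⟩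
  have hroot : (𝐞 (z / n : ℝ) : ℂ) ^ n = 1 := by
    rw [← hpow, mul_div_assoc, div_self hn', mul_one, Real.fourierChar_apply,
      Complex.exp_eq_one_iff]
    exact ⟨z, by push_cast; ring⟩
  simp_rw [hpow]
  rw [Fin.sum_univ_eq_sum_range (fun j => (𝐞 (z / n : ℝ) : ℂ) ^ j), geom_sum_eq hone, hroot]
  simp

theorem sum_prod_fourierChar_eq_zero {ι : Type*} [Fintype ι] [DecidableEq ι] {n : ι → ℕ}
    (hn : ∀ i, 0 < n i) {z : ι → ℤ} {i₀ : ι} (hz : ¬ (n i₀ : ℤ) ∣ z i₀) :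
    ∑ j : ∀ i, Fin (n i), ∏ i, (𝐞 (z i * (j i : ℕ) / n i : ℝ) : ℂ) = 0 := by
  have h := Finset.prod_univ_sum (fun i => (Finset.univ : Finset (Fin (n i))))
    (fun i j => (𝐞 (z i * (j : ℕ) / n i : ℝ) : ℂ))
  rw [Fintype.piFinset_univ] at h
  rw [← h]
  exact Finset.prod_eq_zero (Finset.mem_univ i₀) (sum_fourierChar_eq_zero (hn i₀) hz)

/-- The exponentials on `∏ ℤ / n i` of frequency `k i` in each coordinate. -/
noncomputable def gridChar {ι : Type*} [Fintype ι] {n r : ι → ℕ} (k : ∀ i, Fin (r i))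
    (j : ∀ i, Fin (n i)) : ℂ :=
  ∏ i, (𝐞 ((k i : ℕ) * (j i : ℕ) / n i : ℝ) : ℂ)

theorem gridChar_mul_conj {ι : Type*} [Fintype ι] {n r : ι → ℕ} (k l : ∀ i, Fin (r i))
    (j : ∀ i, Fin (n i)) :
    gridChar k j * conj (gridChar l j) =
      ∏ i, (𝐞 ((((k i : ℕ) - (l i : ℕ) : ℤ) : ℝ) * (j i : ℕ) / n i : ℝ) : ℂ) := by
  simp_rw [gridChar, map_prod, ← Finset.prod_mul_distrib, ← coe_fourierChar_neg,
    ← coe_fourierChar_add]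
  refine Finset.prod_congr rfl fun i _ => ?_
  congr 2
  push_cast
  ring

theorem linearIndependent_gridChar {ι : Type*} [Fintype ι] [DecidableEq ι] {n r : ι → ℕ}
    (hr : ∀ i, r i ≤ n i) (hn : ∀ i, 0 < n i) :
    LinearIndependent ℂ (gridChar : (∀ i, Fin (r i)) → (∀ i, Fin (n i)) → ℂ) := by
  rw [Fintype.linearIndependent_iff]
  intro c hc l
  have h0 : ∑ j : ∀ i, Fin (n i), (∑ k, c k * gridChar k j) * conj (gridChar l j) = 0 := by
    refine Finset.sum_eq_zero fun j _ => ?_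
    have := congrFun hc j
    simp only [Finset.sum_apply, Pi.smul_apply, smul_eq_mul, Pi.zero_apply] at this
    rw [this, zero_mul]
  simp_rw [Finset.sum_mul, mul_assoc] at h0
  rw [Finset.sum_comm] at h0
  simp_rw [← Finset.mul_sum] at h0
  rw [Finset.sum_eq_single l] at h0
  · have h1 : ∑ j : ∀ i, Fin (n i), gridChar l j * conj (gridChar l j) = ∏ i, (n i : ℂ) := by
      simp [gridChar_mul_conj]
    rw [h1] at h0
    refine (mul_eq_zero.1 h0).resolve_right ?_
    exact Finset.prod_ne_zero_iff.2 fun i _ => by exact_mod_cast (hn i).ne'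
  · intro k _ hkl
    obtain ⟨i₀, hi⟩ := Function.ne_iff.1 hkl
    simp_rw [gridChar_mul_conj]
    rw [sum_prod_fourierChar_eq_zero hn (i₀ := i₀), mul_zero]
    intro hd
    have h1 := (k i₀).2
    have h2 := (l i₀).2
    have h3 := hr i₀
    have h4 := Int.eq_zero_of_abs_lt_dvd hd (by rw [abs_lt]; constructor <;> omega)
    exact hi (Fin.ext (by omega))
  · simp

/-- A nowhere vanishing real function which is orthogonal to all products `u k * conj (u l)`
of a linearly independent family has at least as many positive values as the family has members. -/
theorem card_le_card_pos_of_orthogonal {J K : Type*} [Fintype J] [Fintype K]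
    {u : K → J → ℂ} (hu : LinearIndependent ℂ u) {G : J → ℝ} (hG : ∀ j, G j ≠ 0)
    (horth : ∀ k l, ∑ j, (G j : ℂ) * (u k j * conj (u l j)) = 0) :
    Fintype.card K ≤ (Finset.univ.filter fun j => 0 < G j).card := by
  classical
  by_contra! hlt
  let f : (K → ℂ) →ₗ[ℂ] ({j // 0 < G j} → ℂ) :=
    (LinearMap.funLeft ℂ ℂ Subtype.val).comp (Fintype.linearCombination ℂ u)
  have hker : LinearMap.ker f ≠ ⊥ := LinearMap.ker_ne_bot_of_finrank_lt <| by
    rw [Module.finrank_fintype_fun_eq_card, Module.finrank_fintype_fun_eq_card,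
      Fintype.card_subtype]
    exact hlt
  obtain ⟨c, hc, hc0⟩ := (Submodule.ne_bot_iff _).1 hker
  let h : J → ℂ := fun j => ∑ k, c k * u k j
  have hpos : ∀ j, 0 < G j → h j = 0 := fun j hj => by
    have := congrFun (LinearMap.mem_ker.1 hc) ⟨j, hj⟩
    simpa [f, Fintype.linearCombination_apply, LinearMap.funLeft_apply, h] using this
  have hsum : ∑ j, (G j : ℂ) * (h j * conj (h j)) = 0 := by
    have : ∑ j, (G j : ℂ) * (h j * conj (h j)) =
        ∑ k, ∑ l, c k * conj (c l) * ∑ j, (G j : ℂ) * (u k j * conj (u l j)) := by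
      simp_rw [Finset.mul_sum]
      simp_rw [Finset.sum_comm (s := (Finset.univ : Finset K)) (t := (Finset.univ : Finset J))]
      refine Finset.sum_congr rfl fun j _ => ?_
      simp_rw [h, map_sum, map_mul, Finset.sum_mul_sum, Finset.mul_sum]
      refine Finset.sum_congr rfl fun k _ => Finset.sum_congr rfl fun l _ => ?_
      ring
    rw [this]
    simp [horth]
  have hsum' : ∑ j, G j * Complex.normSq (h j) = 0 := by
    simp_rw [Complex.mul_conj] at hsum
    exact_mod_cast hsum
  have hnonpos : ∀ j ∈ Finset.univ, G j * Complex.normSq (h j) ≤ 0 := fun j _ => by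
    rcases lt_or_ge 0 (G j) with hj | hj
    · simp [hpos j hj]
    · exact mul_nonpos_of_nonpos_of_nonneg hj (Complex.normSq_nonneg _)
  have hzero := (Finset.sum_eq_zero_iff_of_nonpos hnonpos).1 hsum'
  have hh : ∀ j, h j = 0 := fun j =>
    Complex.normSq_eq_zero.1 ((mul_eq_zero.1 (hzero j (Finset.mem_univ j))).resolve_left (hG j))
  refine hc0 (funext ((Fintype.linearIndependent_iff.1 hu) c ?_))
  funext j
  simpa [h] using hh j

/-- The real trigonometric sum with frequencies in `Θ` and coefficients `a`, `b`. -/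
noncomputable def trigSum (Θ : Finset ℚ) (a b : ℚ → ℝ) (x : ℝ) : ℝ :=
  ∑ θ ∈ Θ, (a θ * Real.cos (2 * π * (θ : ℝ) * x) + b θ * Real.sin (2 * π * (θ : ℝ) * x))

theorem analyticOnNhd_trigSum (Θ : Finset ℚ) (a b : ℚ → ℝ) :
    AnalyticOnNhd ℝ (trigSum Θ a b) Set.univ := by
  intro x _
  unfold trigSum
  fun_prop

theorem ofReal_trigSum (Θ : Finset ℚ) (a b : ℚ → ℝ) (x : ℝ) :
    (trigSum Θ a b x : ℂ) = ∑ θ ∈ Θ, ((a θ - b θ * Complex.I) / 2 * 𝐞 ((θ : ℝ) * x) +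
      (a θ + b θ * Complex.I) / 2 * 𝐞 (-(θ : ℝ) * x)) := by
  rw [trigSum, Complex.ofReal_sum]
  refine Finset.sum_congr rfl fun θ _ => ?_
  rw [Real.fourierChar_apply, Real.fourierChar_apply, Complex.exp_mul_I, Complex.exp_mul_I]
  have h : 2 * π * (-(θ : ℝ) * x) = -(2 * π * θ * x) := by ring
  rw [h, ← mul_assoc (2 * π)]
  push_cast
  rw [Complex.cos_neg, Complex.sin_neg]
  linear_combination ((b θ : ℂ) * Complex.sin (2 * π * θ * x)) * Complex.I_sq

theorem exists_common_denominator (Θ : Finset ℚ) (hΘ : ∀ θ ∈ Θ, 0 < θ) :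
    ∃ M : ℕ, 0 < M ∧ ∃ κ : ℚ → ℕ, ∀ θ ∈ Θ, 0 < κ θ ∧ (θ : ℝ) = κ θ / M := by
  have hM : 0 < ∏ θ ∈ Θ, θ.den := Finset.prod_pos fun θ _ => θ.den_pos
  refine ⟨∏ θ ∈ Θ, θ.den, hM,
    fun θ => θ.num.toNat * ((∏ θ ∈ Θ, θ.den) / θ.den), fun θ hθ => ?_⟩
  have hd : θ.den ∣ ∏ θ ∈ Θ, θ.den := Finset.dvd_prod_of_mem _ hθ
  have hnum : 0 < θ.num := Rat.num_pos.2 (hΘ θ hθ)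
  refine ⟨Nat.mul_pos (by omega) (Nat.div_pos (Nat.le_of_dvd hM hd) θ.den_pos), ?_⟩
  have hden : (θ.den : ℝ) ≠ 0 := by exact_mod_cast θ.den_ne_zero
  have hM' : ((∏ θ ∈ Θ, θ.den : ℕ) : ℝ) ≠ 0 := by exact_mod_cast hM.ne'
  have hn : ((θ.num.toNat : ℕ) : ℝ) = θ.num := by
    exact_mod_cast Int.toNat_of_nonneg hnum.le
  rw [Nat.cast_mul, Nat.cast_div hd hden, hn, Rat.cast_def]
  field_simp

theorem exists_trigSum_ne_zero {Θ : Finset ℚ} (hΘ : ∀ θ ∈ Θ, 0 < θ) {a b : ℚ → ℝ}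
    (hne : ∃ θ ∈ Θ, a θ ≠ 0 ∨ b θ ≠ 0) : ∃ x, trigSum Θ a b x ≠ 0 := by
  by_contra! hzero
  obtain ⟨θ₀, hθ₀, hab⟩ := hne
  obtain ⟨M, hM, κ, hκ⟩ := exists_common_denominator Θ hΘ
  have hM' : (M : ℝ) ≠ 0 := by positivity
  have hle : ∀ θ ∈ Θ, κ θ ≤ Θ.sup κ := fun θ hθ => Finset.le_sup hθ
  set n : ℕ := 2 * Θ.sup κ + 1 with hn
  have hn0 : 0 < n := by omega
  have hsplit (s : ℤ) (j : Fin n) :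
      (𝐞 ((s / M : ℝ) * ((j : ℕ) * (M / n))) : ℂ) * 𝐞 (-(κ θ₀ * (j : ℕ) / n : ℝ)) =
        𝐞 (((s - κ θ₀ : ℤ) : ℝ) * (j : ℕ) / n : ℝ) := by
    rw [← coe_fourierChar_add]
    congr 2
    push_cast
    field_simp
    ring
  have hterm : ∀ θ ∈ Θ, ∀ j : Fin n,
      ((a θ - b θ * Complex.I) / 2 * 𝐞 ((θ : ℝ) * ((j : ℕ) * (M / n))) +
        (a θ + b θ * Complex.I) / 2 * 𝐞 (-(θ : ℝ) * ((j : ℕ) * (M / n)))) *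
          (𝐞 (-(κ θ₀ * (j : ℕ) / n : ℝ)) : ℂ) =
      (a θ - b θ * Complex.I) / 2 * 𝐞 (((κ θ - κ θ₀ : ℤ) : ℝ) * (j : ℕ) / n : ℝ) +
      (a θ + b θ * Complex.I) / 2 * 𝐞 (((-κ θ - κ θ₀ : ℤ) : ℝ) * (j : ℕ) / n : ℝ) := by
    intro θ hθ j
    rw [← hsplit, ← hsplit, (hκ θ hθ).2]
    push_cast
    rw [neg_div]
    ring
  have hsum : ∑ j : Fin n, (trigSum Θ a b ((j : ℕ) * (M / n)) : ℂ) *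
      𝐞 (-(κ θ₀ * (j : ℕ) / n : ℝ)) = 0 := by
    simp [hzero]
  simp_rw [ofReal_trigSum, Finset.sum_mul] at hsum
  rw [Finset.sum_comm, Finset.sum_congr rfl fun θ hθ => Finset.sum_congr rfl fun j _ =>
    hterm θ hθ j] at hsum
  simp_rw [Finset.sum_add_distrib, ← Finset.mul_sum] at hsum
  rw [← Finset.sum_add_distrib, Finset.sum_eq_single_of_mem θ₀ hθ₀] at hsum
  · rw [sum_fourierChar_eq_zero hn0 (z := -κ θ₀ - κ θ₀)] at hsum
    · have hc : (a θ₀ - b θ₀ * Complex.I : ℂ) = 0 := by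
        have : (n : ℂ) ≠ 0 := by exact_mod_cast hn0.ne'
        simpa [this] using hsum
      have hre := congrArg Complex.re hc
      have him := congrArg Complex.im hc
      simp at hre him
      tauto
    · intro hd
      have h1 := hle θ₀ hθ₀
      have h2 := (hκ θ₀ hθ₀).1
      have := Int.eq_zero_of_abs_lt_dvd hd (by rw [abs_lt]; constructor <;> omega)
      omega
  · intro θ hθ hne'
    have h1 := hle θ₀ hθ₀
    have h2 := (hκ θ₀ hθ₀).1
    have h3 := hle θ hθ
    have h4 := (hκ θ hθ).1
    rw [sum_fourierChar_eq_zero hn0, sum_fourierChar_eq_zero hn0, mul_zero, mul_zero, add_zero]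
    · intro hd
      have := Int.eq_zero_of_abs_lt_dvd hd (by rw [abs_lt]; constructor <;> omega)
      omega
    · intro hd
      have := Int.eq_zero_of_abs_lt_dvd hd (by rw [abs_lt]; constructor <;> omega)
      apply hne'
      have heq : κ θ = κ θ₀ := by omega
      have : (θ : ℝ) = θ₀ := by rw [(hκ θ hθ).2, (hκ θ₀ hθ₀).2, heq]
      exact_mod_cast this

theorem ae_trigSum_ne_zero {Θ : Finset ℚ} (hΘ : ∀ θ ∈ Θ, 0 < θ) {a b : ℚ → ℝ}
    (hne : ∃ θ ∈ Θ, a θ ≠ 0 ∨ b θ ≠ 0) : ∀ᵐ x, trigSum Θ a b x ≠ 0 := by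
  obtain ⟨x, hx⟩ := exists_trigSum_ne_zero hΘ hne
  have h := (analyticOnNhd_trigSum Θ a b).preimage_zero_mem_codiscrete hx
  have h' := ae_restrict_le_codiscreteWithin (μ := volume) MeasurableSet.univ h
  rwa [Measure.restrict_univ] at h'

theorem mul_period_le_card_mul_volume_pos {J : Type*} [Fintype J] {F : ℝ → ℝ}
    (hF : Continuous F) {P : ℝ} (hP : 0 < P) (hper : Function.Periodic F P) (t : J → ℝ) {r : ℕ}
    (hr : ∀ᵐ x, r ≤ (Finset.univ.filter fun j => 0 < F (x + t j)).card) :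
    r * P ≤ Fintype.card J * (volume {x ∈ Set.Icc 0 P | 0 < F x}).toReal := by
  set S : Set ℝ := {x | 0 < F x}
  have hS : MeasurableSet S := measurableSet_lt measurable_const hF.measurable
  let g : ℝ → ℝ := S.indicator 1
  have hgm : Measurable g := measurable_one.indicator hS
  have hgper : Function.Periodic g P := fun x => by
    simp only [g, Set.indicator, S, Set.mem_ofPred_eq, hper x, Pi.one_apply]
  have hgi (s u v : ℝ) : IntervalIntegrable (fun x => g (x + s)) volume u v := by
    refine (intervalIntegrable_const (c := (1 : ℝ))).mono_fun
      (hgm.comp (measurable_add_const s)).aestronglyMeasurable (Filter.Eventually.of_forall ?_)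
    intro x
    by_cases h : x + s ∈ S <;> simp [g, h]
  have hg0 : ∫ x in 0..P, g x = (volume {x ∈ Set.Icc 0 P | 0 < F x}).toReal := by
    rw [intervalIntegral.integral_of_le hP.le, ← integral_Icc_eq_integral_Ioc,
      integral_indicator_one hS, measureReal_restrict_apply hS, Set.inter_comm]
    rfl
  have hgt (s : ℝ) : ∫ x in 0..P, g (x + s) = ∫ x in 0..P, g x := by
    rw [intervalIntegral.integral_comp_add_right, zero_add, add_comm P,
      hgper.intervalIntegral_add_eq s 0, zero_add]
  calc r * P = ∫ _ in 0..P, (r : ℝ) := by simp [mul_comm]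
    _ ≤ ∫ x in 0..P, ∑ j, g (x + t j) := by
      refine intervalIntegral.integral_mono_ae hP.le intervalIntegrable_const
        (by simpa only [Finset.sum_fn] using
          IntervalIntegrable.sum Finset.univ fun j _ => hgi (t j) 0 P) ?_
      filter_upwards [hr] with x hx
      have : ∑ j, g (x + t j) = ((Finset.univ.filter fun j => 0 < F (x + t j)).card : ℝ) := by
        simp [g, Set.indicator, S, Finset.sum_boole]
      rw [this]
      exact_mod_cast hx
    _ = Fintype.card J * (volume {x ∈ Set.Icc 0 P | 0 < F x}).toReal := by
      rw [intervalIntegral.integral_finsetSum fun j _ => hgi _ _ _]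
      simp [hgt, hg0]

/-- The point of the grid with steps `M / n i` and index `j`. -/
noncomputable def gridPoint {ι : Type*} [Fintype ι] (M : ℕ) {n : ι → ℕ} (j : ∀ i, Fin (n i)) : ℝ :=
  ∑ i, (j i : ℕ) * (M / n i : ℝ)

theorem sum_fourierChar_gridPoint_mul_gridChar {ι : Type*} [Fintype ι] [DecidableEq ι]
    {M : ℕ} (hM : 0 < M) {n r : ι → ℕ} (hn : ∀ i, 0 < n i) (k l : ∀ i, Fin (r i)) {s : ℤ}
    {i₀ : ι} (hs : ¬ (n i₀ : ℤ) ∣ s + ((k i₀ : ℕ) - (l i₀ : ℕ))) (x : ℝ) :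
    ∑ j : ∀ i, Fin (n i), (𝐞 ((s / M : ℝ) * (x + gridPoint M j)) : ℂ) *
      (gridChar k j * conj (gridChar l j)) = 0 := by
  have hM' : (M : ℝ) ≠ 0 := by positivity
  have hterm (j : ∀ i, Fin (n i)) : (𝐞 ((s / M : ℝ) * (x + gridPoint M j)) : ℂ) *
      (gridChar k j * conj (gridChar l j)) = 𝐞 ((s / M : ℝ) * x) *
        ∏ i, (𝐞 (((s + ((k i : ℕ) - (l i : ℕ)) : ℤ) : ℝ) * (j i : ℕ) / n i : ℝ) : ℂ) := by
    rw [gridChar_mul_conj, mul_add, coe_fourierChar_add, mul_assoc, gridPoint, Finset.mul_sum,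
      coe_fourierChar_sum, ← Finset.prod_mul_distrib]
    congr 1
    refine Finset.prod_congr rfl fun i _ => ?_
    rw [← coe_fourierChar_add]
    congr 2
    push_cast
    field_simp
  simp_rw [hterm]
  rw [← Finset.mul_sum, sum_prod_fourierChar_eq_zero hn hs, mul_zero]

theorem card_grid_pos_trigSum {ι : Type*} [Fintype ι] [DecidableEq ι] {Θ : Finset ℚ}
    {M : ℕ} (hM : 0 < M) {κ : ℚ → ℕ} (hκ : ∀ θ ∈ Θ, (θ : ℝ) = κ θ / M)
    {α β : ι → ℕ} (hα : ∀ i, 0 < α i) (hcover : ∀ θ ∈ Θ, ∃ i, α i ≤ κ θ ∧ κ θ ≤ β i)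
    (a b : ℚ → ℝ) {x : ℝ}
    (hx : ∀ j : ∀ i, Fin (α i + β i), trigSum Θ a b (x + gridPoint M j) ≠ 0) :
    ∏ i, α i ≤ (Finset.univ.filter fun j : ∀ i, Fin (α i + β i) =>
      0 < trigSum Θ a b (x + gridPoint M j)).card := by
  have hn : ∀ i, 0 < α i + β i := fun i => Nat.add_pos_left (hα i) _
  have hu := linearIndependent_gridChar (r := α) (fun i => Nat.le_add_right (α i) (β i)) hn
  have h := card_le_card_pos_of_orthogonal hu hx ?_
  · simpa using h
  intro k l
  simp_rw [ofReal_trigSum, Finset.sum_mul]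
  rw [Finset.sum_comm]
  refine Finset.sum_eq_zero fun θ hθ => ?_
  obtain ⟨i₀, h1, h2⟩ := hcover θ hθ
  have h3 := (k i₀).2
  have h4 := (l i₀).2
  have hdvd : ∀ s : ℤ, s = κ θ ∨ s = -κ θ →
      ¬ ((α i₀ + β i₀ : ℕ) : ℤ) ∣ s + ((k i₀ : ℕ) - (l i₀ : ℕ)) := by
    intro s hs hd
    have := Int.eq_zero_of_abs_lt_dvd hd (by rw [abs_lt]; constructor <;> omega)
    omega
  have e1 := sum_fourierChar_gridPoint_mul_gridChar hM hn k l (hdvd _ (Or.inl rfl)) x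
  have e2 := sum_fourierChar_gridPoint_mul_gridChar hM hn k l (hdvd _ (Or.inr rfl)) x
  push_cast at e1 e2
  rw [neg_div] at e2
  rw [← hκ θ hθ] at e1 e2
  simp_rw [add_mul _ _ (gridChar _ _ * _), mul_assoc (_ / _ : ℂ)]
  rw [Finset.sum_add_distrib, ← Finset.mul_sum, ← Finset.mul_sum, e1, e2]
  simp

theorem prod_le_density_pos_trigSum {Θ : Finset ℚ} (hΘ : ∀ θ ∈ Θ, 0 < θ)
    {ι : Type*} [Fintype ι] {A B : ι → ℝ} (hseg : ∀ i, 0 < A i ∧ A i ≤ B i)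
    (hcover : ∀ θ ∈ Θ, ∃ i, A i ≤ (θ : ℝ) ∧ (θ : ℝ) ≤ B i)
    {a b : ℚ → ℝ} (hne : ∃ θ ∈ Θ, a θ ≠ 0 ∨ b θ ≠ 0)
    {P : ℝ} (hP : 0 < P) (hper : Function.Periodic (trigSum Θ a b) P) :
    (∏ i, 1 / (1 + B i / A i)) ≤
      (volume {x ∈ Set.Icc 0 P | 0 < trigSum Θ a b x}).toReal / P := by
  classical
  obtain ⟨M, hM, κ, hκ⟩ := exists_common_denominator Θ hΘ
  have hM' : (0 : ℝ) < M := by exact_mod_cast hM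
  let α : ι → ℕ := fun i => ⌈M * A i⌉₊
  let β : ι → ℕ := fun i => max (α i) ⌊M * B i⌋₊
  have hα : ∀ i, 0 < α i := fun i => Nat.ceil_pos.2 (mul_pos hM' (hseg i).1)
  have hcover' : ∀ θ ∈ Θ, ∃ i, α i ≤ κ θ ∧ κ θ ≤ β i := by
    intro θ hθ
    obtain ⟨i, h1, h2⟩ := hcover θ hθ
    have hθM : (κ θ : ℝ) = M * θ := by
      rw [(hκ θ hθ).2]
      field_simp
    refine ⟨i, Nat.ceil_le.2 ?_, le_max_of_le_right (Nat.le_floor ?_)⟩ <;> rw [hθM] <;> gcongr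
  have hratio : ∀ i, 1 / (1 + B i / A i) ≤ α i / (α i + β i : ℝ) := by
    intro i
    have hA := (hseg i).1
    have hAB := (hseg i).2
    have hB := hA.trans_le hAB
    have hα' : (0 : ℝ) < α i := by exact_mod_cast hα i
    have hαA : M * A i ≤ α i := Nat.le_ceil _
    have hβ : (β i : ℝ) / α i ≤ B i / A i := by
      rw [div_le_div_iff₀ hα' hA, Nat.cast_max]
      rcases max_cases (α i : ℝ) ((⌊M * B i⌋₊ : ℕ) : ℝ) with ⟨h, _⟩ | ⟨h, _⟩ <;> rw [h]
      · nlinarith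
      · have := Nat.floor_le (mul_pos hM' hB).le
        nlinarith
    have heq : (α i : ℝ) / (α i + β i) = 1 / (1 + β i / α i) := by
      field_simp
    rw [heq]
    gcongr
  have hpos : ∀ᵐ x, ∏ i, α i ≤ (Finset.univ.filter fun j : ∀ i, Fin (α i + β i) =>
      0 < trigSum Θ a b (x + gridPoint M j)).card := by
    have hae : ∀ᵐ x, ∀ j : ∀ i, Fin (α i + β i), trigSum Θ a b (x + gridPoint M j) ≠ 0 :=
      ae_all_iff.2 fun j => (measurePreserving_add_right volume
        (gridPoint M j)).quasiMeasurePreserving.ae (ae_trigSum_ne_zero hΘ hne)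
    filter_upwards [hae] with x hx
    exact card_grid_pos_trigSum hM (fun θ hθ => (hκ θ hθ).2) hα hcover' a b hx
  have hcont : Continuous (trigSum Θ a b) := by
    unfold trigSum
    fun_prop
  have hle := mul_period_le_card_mul_volume_pos hcont hP hper _ hpos
  have hprod : (0 : ℝ) < ∏ i, (α i + β i : ℝ) :=
    Finset.prod_pos fun i _ => by exact_mod_cast Nat.add_pos_left (hα i) _
  have hfactor : ∀ i, 0 ≤ 1 / (1 + B i / A i) := fun i => by
    have hA := (hseg i).1
    have hB := hA.trans_le (hseg i).2
    positivity
  calc ∏ i, 1 / (1 + B i / A i) ≤ ∏ i, α i / (α i + β i : ℝ) :=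
      Finset.prod_le_prod (fun i _ => hfactor i) fun i _ => hratio i
    _ ≤ _ := by
      rw [Finset.prod_div_distrib, div_le_div_iff₀ hprod hP]
      simpa [mul_comm] using hle

/-- If the spectrum `Θ` of a nonzero trigonometric sum `F` consists of positive rationals
contained in `[a₁;b₁] ∪ … ∪ [a_m;b_m]` with `0 < aᵢ ≤ bᵢ`, then
`min(ρ₊(F), ρ₋(F)) ≥ ∏ᵢ 1/(1 + bᵢ/aᵢ)` (where `ρ±` are computed with respect to any
period `P > 0` of `F`). -/
theorem stmt_8 (Θ : Finset ℚ) (hΘ : ∀ θ ∈ Θ, 0 < θ)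
    (m : ℕ) (A B : Fin m → ℝ) (hseg : ∀ i, 0 < A i ∧ A i ≤ B i)
    (hcover : ∀ θ ∈ Θ, ∃ i, A i ≤ (θ : ℝ) ∧ (θ : ℝ) ≤ B i)
    (a b : ℚ → ℝ) (hne : ∃ θ ∈ Θ, a θ ≠ 0 ∨ b θ ≠ 0)
    (F : ℝ → ℝ)
    (hF : F = fun x => ∑ θ ∈ Θ, (a θ * Real.cos (2 * π * (θ : ℝ) * x)
      + b θ * Real.sin (2 * π * (θ : ℝ) * x)))
    (P : ℝ) (hP : 0 < P) (hper : Function.Periodic F P) :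
    (∏ i, 1 / (1 + B i / A i)) ≤
      min ((volume {x ∈ Set.Icc 0 P | 0 < F x}).toReal / P)
          ((volume {x ∈ Set.Icc 0 P | F x < 0}).toReal / P) := by
  have hF' : F = trigSum Θ a b := hF
  have hneg : ∀ x, trigSum Θ (-a) (-b) x = -trigSum Θ a b x := fun x => by
    simp only [trigSum, Pi.neg_apply, ← Finset.sum_neg_distrib]
    exact Finset.sum_congr rfl fun θ _ => by ring
  subst hF'
  refine le_min (prod_le_density_pos_trigSum hΘ hseg hcover hne hP hper) ?_
  have h := prod_le_density_pos_trigSum hΘ hseg hcover (a := -a) (b := -b) (by simpa using hne) hP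
    fun x => by rw [hneg, hneg, hper x]
  simpa only [hneg, neg_pos] using h
end

section
/- Let p and q be coprime positive integers with p + q odd, and let A, B be real numbers, not both zero. Define F(x) = A·cos(px) + B·cos(qx). Then min(ρ₊(F), ρ₋(F)) ≥ 1/2 − 1/(2(p+q)). -/
open MeasureTheory
open scoped Real

/-- A nonzero linear combination of `cos` and `sin` is a phase-shifted cosine. -/
lemma exists_amplitude_phase (C D : ℝ) (h : C ≠ 0 ∨ D ≠ 0) :
    ∃ R φ : ℝ, 0 < R ∧ ∀ θ : ℝ, C * Real.cos θ + D * Real.sin θ = R * Real.cos (θ - φ) := by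
  set z : ℂ := ⟨C, D⟩ with hz
  have hz0 : z ≠ 0 := by
    rintro h0
    have h1 := congrArg Complex.re h0
    have h2 := congrArg Complex.im h0
    simp only [hz, Complex.zero_re, Complex.zero_im] at h1 h2
    tauto
  refine ⟨‖z‖, z.arg, norm_pos_iff.mpr hz0, fun θ => ?_⟩
  have h1 : ‖z‖ * Real.cos z.arg = C := Complex.norm_mul_cos_arg z
  have h2 : ‖z‖ * Real.sin z.arg = D := Complex.norm_mul_sin_arg z
  rw [Real.cos_sub, ← h1, ← h2]
  ring

/-- An open half-turn contains `(N - 1) / 2` consecutive multiples of `2π / N` for odd `N`. -/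
lemma exists_consecutive_cos_pos (M : ℕ) (φ : ℝ) :
    ∃ n : ℤ, ∀ i : ℕ, i < M →
      0 < Real.cos (2 * π * ((n + i : ℤ) : ℝ) / (2 * M + 1) - φ) := by
  set N : ℝ := 2 * M + 1 with hN
  have hNpos : 0 < N := by positivity
  set a : ℝ := (φ - π / 2) * N / (2 * π) with ha
  have hpi := Real.pi_pos
  have ha' : 2 * π * a / N = φ - π / 2 := by rw [ha]; field_simp
  refine ⟨⌊a⌋ + 1, fun i hi => ?_⟩
  have h1 := Int.lt_floor_add_one a
  have h2 := Int.floor_le a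
  have hi' : (i : ℝ) + 1 ≤ M := by exact_mod_cast hi
  have hi0 : (0 : ℝ) ≤ i := Nat.cast_nonneg i
  set t : ℝ := ((⌊a⌋ + 1 + i : ℤ) : ℝ) with ht
  have ht' : t = ⌊a⌋ + 1 + i := by rw [ht]; push_cast; ring
  have hl : a < t := by linarith
  have hu : t < a + N / 2 := by linarith
  apply Real.cos_pos_of_mem_Ioo
  have e1 : 2 * π * a / N < 2 * π * t / N := by gcongr
  have e2 : 2 * π * t / N < 2 * π * (a + N / 2) / N := by gcongr
  have e3 : 2 * π * (a + N / 2) / N = 2 * π * a / N + π := by field_simp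
  constructor <;> linarith

/-- Along an arithmetic progression of step `2π / (p + q)` the sum of two cosines is a single
sampled cosine, hence is positive at nearly half of the points. -/
lemma card_pos_le (p q M : ℕ) (hcop : Nat.Coprime p q) (hM : p + q = 2 * M + 1) (A B x : ℝ)
    (hx : Real.sin ((p + q) * x) ≠ 0) (hne : A ≠ 0 ∨ B ≠ 0) :
    M ≤ ((Finset.range (p + q)).filter fun k : ℕ =>
      0 < A * Real.cos (p * (x + 2 * π * k / (p + q)))
        + B * Real.cos (q * (x + 2 * π * k / (p + q)))).card := by
  have hadd : Real.sin ((p + q) * x)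
      = Real.sin (p * x) * Real.cos (q * x) + Real.cos (p * x) * Real.sin (q * x) := by
    rw [add_mul, Real.sin_add]
  have hCD : A * Real.cos (p * x) + B * Real.cos (q * x) ≠ 0 ∨
      B * Real.sin (q * x) - A * Real.sin (p * x) ≠ 0 := by
    by_contra! h
    obtain ⟨h1, h2⟩ := h
    have hA : A * Real.sin ((p + q) * x) = 0 := by
      rw [hadd]
      linear_combination Real.sin (q * x) * h1 - Real.cos (q * x) * h2
    have hB : B * Real.sin ((p + q) * x) = 0 := by
      rw [hadd]
      linear_combination Real.sin (p * x) * h1 + Real.cos (p * x) * h2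
    rcases hne with h | h
    · exact (mul_ne_zero h hx) hA
    · exact (mul_ne_zero h hx) hB
  obtain ⟨R, φ, hR, hφ⟩ := exists_amplitude_phase _ _ hCD
  obtain ⟨n, hn⟩ := exists_consecutive_cos_pos M φ
  have hNpos : 0 < p + q := by omega
  have hcopN : IsCoprime (p : ℤ) ((p + q : ℕ) : ℤ) := by
    rw [Nat.isCoprime_iff_coprime]
    simpa using hcop
  obtain ⟨u, v, huv⟩ := hcopN
  have hNz : (0 : ℤ) < ((p + q : ℕ) : ℤ) := by exact_mod_cast hNpos
  set N : ℤ := ((p + q : ℕ) : ℤ) with hN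
  have hNR : (N : ℝ) = p + q := by rw [hN]; push_cast; ring
  have hNR0 : (p + q : ℝ) ≠ 0 := by exact_mod_cast hNpos.ne'
  have hnn : ∀ m : ℤ, 0 ≤ (u * m) % N := fun m => Int.emod_nonneg _ hNz.ne'
  have key : ∀ m : ℤ, ∃ l : ℤ, p * ((u * m) % N) = m + N * l := by
    intro m
    refine ⟨-v * m - p * (u * m / N), ?_⟩
    linear_combination m * huv + (p : ℤ) * Int.emod_add_mul_ediv (u * m) N
  conv_lhs => rw [← Finset.card_range M]
  refine Finset.card_le_card_of_injOn (fun i : ℕ => ((u * (n + i)) % N).toNat) ?_ ?_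
  · intro i hi
    have hi : i < M := by simpa using hi
    obtain ⟨l, hl⟩ := key (n + i)
    have hk0 := hnn (n + i)
    have hkN := Int.emod_lt_of_pos (u * (n + i)) hNz
    have hpos := hn i hi
    simp only [Finset.coe_filter, Set.mem_ofPred_eq, Finset.mem_range]
    generalize (u * (n + (i : ℤ))) % N = k at *
    refine ⟨by omega, ?_⟩
    have hcast : ((k.toNat : ℕ) : ℝ) = (k : ℝ) := by
      exact_mod_cast congrArg (Int.cast (R := ℝ)) (Int.toNat_of_nonneg hk0)
    rw [hcast]
    set m : ℤ := n + i with hm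
    have hlR : (p : ℝ) * k = m + (p + q) * l := by
      rw [← hNR]; exact_mod_cast hl
    set θ : ℝ := 2 * π * (m : ℝ) / (p + q) with hθ
    have e1 : (p : ℝ) * (x + 2 * π * k / (p + q)) = p * x + θ + l * (2 * π) := by
      rw [hθ]; field_simp; linear_combination 2 * π * hlR
    have e2 : (q : ℝ) * (x + 2 * π * k / (p + q)) = q * x - θ + (k - l : ℤ) * (2 * π) := by
      rw [hθ]; push_cast; field_simp; linear_combination -2 * π * hlR
    rw [e1, e2, Real.cos_add_int_mul_two_pi, Real.cos_add_int_mul_two_pi, Real.cos_add,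
      Real.cos_sub]
    have hMR : (2 * M + 1 : ℝ) = p + q := by exact_mod_cast hM.symm
    rw [hMR] at hpos
    have := mul_pos hR hpos
    rw [← hφ] at this
    linarith
  · intro i hi j hj hij
    have hi : i < M := by simpa using hi
    have hj : j < M := by simpa using hj
    obtain ⟨l, hl⟩ := key (n + i)
    obtain ⟨l', hl'⟩ := key (n + j)
    have h1 := hnn (n + i)
    have h2 := hnn (n + j)
    have hij' : (u * (n + (i : ℤ))) % N = (u * (n + (j : ℤ))) % N := by
      have : ((u * (n + (i : ℤ))) % N).toNat = ((u * (n + (j : ℤ))) % N).toNat := hij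
      omega
    rw [hij'] at hl
    have hd : N ∣ (i : ℤ) - j := ⟨l' - l, by linear_combination hl' - hl⟩
    have := Int.eq_zero_of_abs_lt_dvd hd (by rw [abs_lt]; omega)
    omega

lemma ae_sin_mul_ne_zero {c : ℝ} (hc : c ≠ 0) : ∀ᵐ x : ℝ, Real.sin (c * x) ≠ 0 := by
  have hsub : {x : ℝ | Real.sin (c * x) = 0} ⊆ Set.range fun n : ℤ => (n : ℝ) * π / c := by
    intro x hx
    obtain ⟨n, hn⟩ := Real.sin_eq_zero_iff.mp hx
    exact ⟨n, by simp only [hn]; field_simp⟩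
  rw [ae_iff]
  simpa using ((Set.countable_range _).mono hsub).measure_zero volume

/-- The positive set of `A cos(px) + B cos(qx)` fills at least `1/2 - 1/(2(p+q))` of a period. -/
lemma volume_pos_ratio_le (p q : ℕ) (hcop : Nat.Coprime p q) (hodd : Odd (p + q)) (A B : ℝ)
    (hne : A ≠ 0 ∨ B ≠ 0) :
    (1 : ℝ) / 2 - 1 / (2 * (p + q)) ≤
      (volume {x ∈ Set.Icc (0:ℝ) (2*π) |
        0 < A * Real.cos (p * x) + B * Real.cos (q * x)}).toReal / (2*π) := by
  obtain ⟨M, hM⟩ := hodd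
  have hNpos : (0 : ℝ) < p + q := by exact_mod_cast (by omega : 0 < p + q)
  have hpi := Real.pi_pos
  set F : ℝ → ℝ := fun x => A * Real.cos (p * x) + B * Real.cos (q * x) with hF
  have hFc : Continuous F := by fun_prop
  have hFp : Function.Periodic F (2 * π) := by
    intro x
    simp only [hF, mul_add, Real.cos_add_nat_mul_two_pi]
  set S : Set ℝ := {x | 0 < F x} with hS
  have hSm : MeasurableSet S := (isOpen_lt continuous_const hFc).measurableSet
  set f : ℝ → ℝ := S.indicator 1 with hf
  have hfm : Measurable f := measurable_one.indicator hSm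
  have hfp : Function.Periodic f (2 * π) := by
    intro x
    simp only [hf, hS, Set.indicator_apply, Set.mem_ofPred_eq, hFp x, Pi.one_apply]
  have hfi : ∀ c a b : ℝ, IntervalIntegrable (fun x => f (x + c)) volume a b := by
    intro c a b
    refine (intervalIntegrable_const (c := (1 : ℝ))).mono_fun
      (hfm.comp (measurable_id.add_const c)).aestronglyMeasurable
      (Filter.Eventually.of_forall fun x => ?_)
    simp only [hf, Set.indicator_apply]
    split_ifs <;> simp
  have hvol : (volume {x ∈ Set.Icc (0:ℝ) (2*π) | 0 < F x}).toReal = ∫ x in (0:ℝ)..2 * π, f x := by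
    rw [intervalIntegral.integral_of_le (by positivity), ← integral_Icc_eq_integral_Ioc, hf,
      integral_indicator_one hSm, measureReal_def, Measure.restrict_apply hSm, Set.inter_comm]
    rfl
  have hshift : ∀ c : ℝ, ∫ x in (0:ℝ)..2 * π, f (x + c) = ∫ x in (0:ℝ)..2 * π, f x := by
    intro c
    rw [intervalIntegral.integral_comp_add_right, zero_add, add_comm (2 * π) c,
      hfp.intervalIntegral_add_eq c 0, zero_add]
  have hsum : ∫ x in (0:ℝ)..2 * π, ∑ k ∈ Finset.range (p + q), f (x + 2 * π * k / (p + q))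
      = (p + q) * ∫ x in (0:ℝ)..2 * π, f x := by
    rw [intervalIntegral.integral_finsetSum fun k _ => hfi _ _ _]
    simp [hshift]
  have hae : ∀ᵐ x : ℝ,
      (M : ℝ) ≤ ∑ k ∈ Finset.range (p + q), f (x + 2 * π * k / (p + q)) := by
    filter_upwards [ae_sin_mul_ne_zero hNpos.ne'] with x hx
    have := card_pos_le p q M hcop hM A B x hx hne
    simp only [hf, hS, Set.indicator_apply, Set.mem_ofPred_eq, Pi.one_apply, Finset.sum_boole]
    exact_mod_cast this
  have hint : ∫ _ in (0:ℝ)..2 * π, (M : ℝ) ≤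
      ∫ x in (0:ℝ)..2 * π, ∑ k ∈ Finset.range (p + q), f (x + 2 * π * k / (p + q)) :=
    intervalIntegral.integral_mono_ae (by positivity) intervalIntegrable_const
      (by simpa only [Finset.sum_fn] using
        IntervalIntegrable.sum (Finset.range (p + q)) fun k _ => hfi (2 * π * k / (p + q)) 0 (2 * π))
      hae
  rw [hsum, intervalIntegral.integral_const, sub_zero, smul_eq_mul, ← hvol] at hint
  have hMR : (p + q : ℝ) = 2 * M + 1 := by exact_mod_cast hM
  have hlhs : (1 : ℝ) / 2 - 1 / (2 * (p + q)) = M / (p + q) := by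
    field_simp; linarith
  rw [hlhs, div_le_div_iff₀ hNpos (by positivity)]
  linarith

/-- For coprime positive integers `p, q` with `p + q` odd and `F(x) = A cos(px) + B cos(qx)`
nonzero (period `2π`), `min(ρ₊(F), ρ₋(F)) ≥ 1/2 − 1/(2(p+q))`. -/
theorem stmt_9 (p q : ℕ) (hp : 0 < p) (hq : 0 < q) (hcop : Nat.Coprime p q)
    (hodd : Odd (p + q)) (A B : ℝ) (hne : A ≠ 0 ∨ B ≠ 0) :
    (1 : ℝ) / 2 - 1 / (2 * (p + q)) ≤
      min ((volume {x ∈ Set.Icc (0:ℝ) (2*π) |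
              0 < A * Real.cos (p * x) + B * Real.cos (q * x)}).toReal / (2*π))
          ((volume {x ∈ Set.Icc (0:ℝ) (2*π) |
              A * Real.cos (p * x) + B * Real.cos (q * x) < 0}).toReal / (2*π)) := by
  refine le_min (volume_pos_ratio_le p q hcop hodd A B hne) ?_
  have hneg := volume_pos_ratio_le p q hcop hodd (-A) (-B) (by simpa using hne)
  have hiff : ∀ x : ℝ, 0 < -A * Real.cos (p * x) + -B * Real.cos (q * x) ↔
      A * Real.cos (p * x) + B * Real.cos (q * x) < 0 := fun x => by
    constructor <;> intro h <;> linarith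
  simpa only [hiff] using hneg
end
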